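/- arXiv:1411.3120 — 2 statements merged into one kernel-verified Lean document; each statement's English description precedes it below -/
import Mathlib

section
/- Assume all masses M_0, …, M_r are strictly positive, and assume there are sequences a_n, b_n > 0 with a_n^{−1/2}/(A n^a) → 1 and b_n/(B n^b) → 1 for constants A, B, b > 0 and a ∈ ℝ, and ν > −1 with 2a+1 = b(ν+1), such that for every j = 0,…,r+1, uniformly on compact subsets of ℂ, (−1)^n (a_n^{1/2}/b_n^j) p_n^{[2j]}(c + z²/b_n) → φ_{ν+2j}(z). Then lim_{n→∞} q_n^{(r+1)}(c) / p_n^{(r+1)}(c) = (r+1)! · Γ(ν+r+2) / Γ(ν+2r+3). -/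
open MeasureTheory Polynomial Filter Topology

noncomputable section

/-- The support of a Borel measure on `ℝ`. -/
def measSupport (μ : Measure ℝ) : Set ℝ := {x | ∀ U ∈ nhds x, μ U ≠ 0}

/-- `P` is a sequence of orthonormal polynomials with respect to the measure `μ`. -/
def IsOPS (μ : Measure ℝ) (P : ℕ → Polynomial ℝ) : Prop :=
  (∀ n, (P n).degree = n) ∧ (∀ n, 0 < (P n).leadingCoeff) ∧
    ∀ n m, (∫ x, (P n).eval x * (P m).eval x ∂μ) = if n = m then 1 else 0

/-- The modified measure `dμ_j(x) = (x-c)^j dμ(x)`. -/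
def muMod (μ : Measure ℝ) (c : ℝ) (j : ℕ) : Measure ℝ :=
  μ.withDensity fun x => ENNReal.ofReal ((x - c) ^ j)

/-- The discrete Sobolev inner product. -/
def sobInner (μ : Measure ℝ) (c : ℝ) (r : ℕ) (M : ℕ → ℝ) (p q : Polynomial ℝ) : ℝ :=
  (∫ x, p.eval x * q.eval x ∂μ) +
    ∑ i ∈ Finset.range (r + 1),
      M i * (Polynomial.derivative^[i] p).eval c * (Polynomial.derivative^[i] q).eval c

/-- `Q` is the sequence of orthonormal polynomials for the Sobolev inner product. -/
def IsSobOPS (μ : Measure ℝ) (c : ℝ) (r : ℕ) (M : ℕ → ℝ) (Q : ℕ → Polynomial ℝ) : Prop :=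
  (∀ n, (Q n).degree = n) ∧ (∀ n, 0 < (Q n).leadingCoeff) ∧
    ∀ n m, sobInner μ c r M (Q n) (Q m) = if n = m then 1 else 0

/-- `φ_ν(z) = Σ_{k≥0} (-1)^k z^{2k} / (k! Γ(k+ν+1)) = z^{-ν} J_ν(2z)`. -/
def phi (ν : ℝ) (z : ℂ) : ℂ :=
  ∑' k : ℕ, ((-1 : ℂ) ^ k * z ^ (2 * k)) /
    ((k.factorial : ℂ) * Complex.Gamma ((k : ℂ) + (ν : ℂ) + 1))

/-- Locally uniform convergence of polynomials forces convergence of all derivatives at `0`. -/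
theorem tendsto_iterate_derivative_eval_zero {U : Set ℂ} (hU : IsOpen U) (h0 : (0 : ℂ) ∈ U)
    (k : ℕ) : ∀ (F : ℕ → ℂ[X]) (f : ℂ → ℂ),
      TendstoLocallyUniformlyOn (fun n z => (F n).eval z) f atTop U →
      Tendsto (fun n => (derivative^[k] (F n)).eval 0) atTop (𝓝 (iteratedDeriv k f 0)) := by
  induction k with
  | zero => intro F f h; simpa using h.tendsto_at h0
  | succ k ih =>
    intro F f h
    have h' := h.deriv (Eventually.of_forall fun n => (F n).differentiable.differentiableOn) hU
    have := ih (fun n => derivative (F n)) (deriv f) (by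
      refine h'.congr fun n z _ => ?_
      simp)
    simpa [iteratedDeriv_succ'] using this

theorem iterate_derivative_comp_linear {R : Type*} [CommRing R] (f : R[X]) (c t : R) (k : ℕ) :
    derivative^[k] (f.comp (C c + C t * X)) =
      C (t ^ k) * (derivative^[k] f).comp (C c + C t * X) := by
  induction k with
  | zero => simp
  | succ k ih =>
    rw [Function.iterate_succ_apply', ih, Function.iterate_succ_apply']
    simp only [derivative_C_mul, derivative_comp, derivative_add, derivative_C, derivative_X,
      mul_one, zero_add, pow_succ, C_mul]
    ring

/-- The coefficients of `φ_ν` as a power series in `z²`. -/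
def phiCoeff (ν : ℝ) (k : ℕ) : ℂ :=
  (-1 : ℂ) ^ k / ((k.factorial : ℂ) * Complex.Gamma ((k : ℂ) + (ν : ℂ) + 1))

theorem phiCoeff_eq_ofReal (ν : ℝ) (k : ℕ) :
    phiCoeff ν k = (((-1) ^ k / (k.factorial * Real.Gamma (k + ν + 1)) : ℝ) : ℂ) := by
  simp [phiCoeff, ← Complex.Gamma_ofReal]

theorem phi_eq_tsum (ν : ℝ) (z : ℂ) : phi ν z = ∑' k : ℕ, phiCoeff ν k * (z ^ 2) ^ k := by
  unfold phi phiCoeff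
  refine tsum_congr fun k => ?_
  rw [← pow_mul]
  ring

theorem summable_norm_phiCoeff {ν : ℝ} (hν : -1 < ν) : Summable fun k => ‖phiCoeff ν k‖ := by
  have hpos : ∀ k : ℕ, 0 < Real.Gamma (k + ν + 1) := fun k =>
    Real.Gamma_pos_of_pos (by have : (0 : ℝ) ≤ k := k.cast_nonneg; linarith)
  have hlow : ∀ k : ℕ, 1 ≤ k → min 1 (ν + 1) * Real.Gamma (ν + 1) ≤ Real.Gamma (k + ν + 1) := by
    have h0 : 0 < Real.Gamma (ν + 1) := by simpa using hpos 0
    intro k hk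
    induction k, hk using Nat.le_induction with
    | base =>
      rw [show ((1 : ℕ) : ℝ) + ν + 1 = (ν + 1) + 1 by push_cast; ring,
        Real.Gamma_add_one (s := ν + 1) (by linarith)]
      exact mul_le_mul_of_nonneg_right (min_le_right _ _) h0.le
    | succ k hk ih =>
      have hk' : (1 : ℝ) ≤ k := by exact_mod_cast hk
      rw [show ((k + 1 : ℕ) : ℝ) + ν + 1 = (k + ν + 1) + 1 by push_cast; ring,
        Real.Gamma_add_one (s := k + ν + 1) (by linarith)]
      have h1 := min_le_left 1 (ν + 1)
      have h2 := min_le_right 1 (ν + 1)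
      nlinarith [hpos k]
  have hm : 0 < min 1 (ν + 1) * Real.Gamma (ν + 1) :=
    mul_pos (lt_min one_pos (by linarith)) (by simpa using hpos 0)
  rw [← summable_nat_add_iff 1]
  have hs : Summable fun k : ℕ =>
      (min 1 (ν + 1) * Real.Gamma (ν + 1))⁻¹ * ((1 : ℝ) ^ (k + 1) / (k + 1).factorial) :=
    ((summable_nat_add_iff 1).2 (Real.summable_pow_div_factorial 1)).mul_left _
  refine hs.of_nonneg_of_le (fun _ => norm_nonneg _) fun k => ?_
  rw [phiCoeff_eq_ofReal, Complex.norm_real, Real.norm_eq_abs, abs_div, abs_pow, abs_neg, abs_one,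
    abs_mul, Nat.abs_cast, abs_of_pos (hpos _), one_pow, ← div_eq_inv_mul, div_div]
  have h1 := hlow (k + 1) (by omega)
  have h2 : (0 : ℝ) < (k + 1).factorial := by positivity
  gcongr

theorem iteratedDeriv_tsum_phiCoeff {ν : ℝ} (hν : -1 < ν) (k : ℕ) :
    iteratedDeriv k (fun w : ℂ => ∑' i : ℕ, phiCoeff ν i * w ^ i) 0 =
      k.factorial * phiCoeff ν k := by
  have hu : TendstoUniformlyOn
      (fun n w => ∑ i ∈ Finset.range n, phiCoeff ν i * w ^ i)
      (fun w : ℂ => ∑' i : ℕ, phiCoeff ν i * w ^ i) atTop (Metric.ball 0 1) := by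
    refine tendstoUniformlyOn_tsum_nat (summable_norm_phiCoeff hν) fun n w hw => ?_
    rw [norm_mul, norm_pow]
    have hw1 : ‖w‖ ≤ 1 := (mem_ball_zero_iff.1 hw).le
    exact mul_le_of_le_one_right (norm_nonneg _) (pow_le_one₀ (norm_nonneg _) hw1)
  have h := tendsto_iterate_derivative_eval_zero Metric.isOpen_ball (Metric.mem_ball_self one_pos) k
    (fun n => ∑ i ∈ Finset.range n, C (phiCoeff ν i) * X ^ i) _
    (hu.tendstoLocallyUniformlyOn.congr fun n w _ => by simp [eval_finsetSum])
  refine tendsto_nhds_unique h (tendsto_const_nhds.congr' ?_)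
  filter_upwards [eventually_gt_atTop k] with n hn
  rw [← coeff_zero_eq_eval_zero, coeff_iterate_derivative, finsetSum_coeff]
  simp [coeff_X_pow, hn, Nat.descFactorial_self]

/-- The Mehler–Heine asymptotics imply the asymptotics of the derivatives at the point `c`. -/
theorem tendsto_derivative_of_mehlerHeine {ν : ℝ} (hν : -1 < ν) (c : ℝ) (p : ℕ → ℝ[X])
    (s b : ℕ → ℝ)
    (h : ∀ K : Set ℂ, IsCompact K → TendstoUniformlyOn
      (fun (n : ℕ) (z : ℂ) => (s n : ℂ) * aeval ((c : ℂ) + z ^ 2 / (b n : ℂ)) (p n))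
      (fun z => phi ν z) atTop K) (k : ℕ) :
    Tendsto (fun n => s n * (b n)⁻¹ ^ k * (derivative^[k] (p n)).eval c) atTop
      (𝓝 ((-1) ^ k / Real.Gamma (k + ν + 1))) := by
  have hu : TendstoUniformlyOn
      (fun (n : ℕ) (w : ℂ) => (s n : ℂ) * aeval ((c : ℂ) + w / (b n : ℂ)) (p n))
      (fun w : ℂ => ∑' i : ℕ, phiCoeff ν i * w ^ i) atTop (Metric.ball 0 1) := by
    have h1 := Metric.tendstoUniformlyOn_iff.1 (h _ (isCompact_closedBall 0 1))
    refine Metric.tendstoUniformlyOn_iff.2 fun ε hε => ?_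
    filter_upwards [h1 ε hε] with n hn w hw
    obtain ⟨z, rfl⟩ : ∃ z : ℂ, z ^ 2 = w := ⟨w ^ ((1 : ℂ) / 2), by
      rw [← Complex.cpow_nat_mul]; simp⟩
    rw [← phi_eq_tsum]
    refine hn z ?_
    rw [mem_ball_zero_iff, norm_pow] at hw
    rw [mem_closedBall_zero_iff]
    by_contra! hz
    nlinarith
  have h2 := tendsto_iterate_derivative_eval_zero Metric.isOpen_ball
    (Metric.mem_ball_self one_pos) k
    (fun n => C (s n : ℂ) * ((p n).map (algebraMap ℝ ℂ)).comp (C (c : ℂ) + C ((b n : ℂ)⁻¹) * X)) _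
    (hu.tendstoLocallyUniformlyOn.congr fun n w _ => by
      simp [eval_comp, eval_map_algebraMap, div_eq_inv_mul])
  rw [iteratedDeriv_tsum_phiCoeff hν] at h2
  have h3 := (Complex.continuous_re.tendsto _).comp h2
  convert h3 using 2 with n
  · simp only [Function.comp_apply, iterate_derivative_C_mul, iterate_derivative_comp_linear,
      iterate_derivative_map, eval_mul, eval_C, eval_comp, eval_add, eval_X, mul_zero, add_zero]
    rw [eval_map_algebraMap]
    have : aeval (c : ℂ) (derivative^[k] (p n)) = (((derivative^[k] (p n)).eval c : ℝ) : ℂ) := by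
      have := aeval_algebraMap_apply ℂ c (derivative^[k] (p n))
      simpa using this
    rw [this]
    norm_cast
    ring
  · rw [phiCoeff_eq_ofReal]
    norm_cast
    have : (k.factorial : ℝ) ≠ 0 := by positivity
    field_simp

/-- Sums of sequences with power growth of exponent `t > -1`. -/
theorem tendsto_sum_range_div_rpow {u : ℕ → ℝ} {t L : ℝ} (ht : 0 < t + 1)
    (hu : Tendsto (fun n : ℕ => u n / (n : ℝ) ^ t) atTop (𝓝 L)) :
    Tendsto (fun n : ℕ => (∑ k ∈ Finset.range n, u k) / (n : ℝ) ^ (t + 1)) atTop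
      (𝓝 (L / (t + 1))) := by
  set g : ℕ → ℝ := fun k => ((k + 1 : ℕ) : ℝ) ^ (t + 1) - (k : ℝ) ^ (t + 1) with hg
  have hsum : ∀ n, ∑ k ∈ Finset.range n, g k = (n : ℝ) ^ (t + 1) := fun n => by
    rw [hg, Finset.sum_range_sub (fun k : ℕ => (k : ℝ) ^ (t + 1))]
    simp [Real.zero_rpow ht.ne']
  have hg0 : 0 ≤ g := fun k => sub_nonneg.2
    (Real.rpow_le_rpow k.cast_nonneg (by push_cast; linarith) ht.le)
  have hpow : Tendsto (fun n : ℕ => (n : ℝ) ^ (t + 1)) atTop atTop :=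
    (tendsto_rpow_atTop ht).comp tendsto_natCast_atTop_atTop
  have hgt : Tendsto (fun n : ℕ => g n / (n : ℝ) ^ t) atTop (𝓝 (t + 1)) := by
    have hd : HasDerivAt (fun x : ℝ => x ^ (t + 1)) (t + 1) 1 := by
      simpa using Real.hasDerivAt_rpow_const (x := 1) (p := t + 1) (Or.inl one_ne_zero)
    have h1 := hd.tendsto_slope_zero_right
    have h2 : Tendsto (fun n : ℕ => ((n : ℝ))⁻¹) atTop (𝓝[>] 0) :=
      tendsto_inv_atTop_nhdsGT_zero.comp tendsto_natCast_atTop_atTop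
    refine (h1.comp h2).congr' ?_
    filter_upwards [eventually_gt_atTop 0] with n hn
    have hn' : (0 : ℝ) < n := by exact_mod_cast hn
    have e1 : (n : ℝ) ^ (t + 1) = n ^ t * n := Real.rpow_add_one hn'.ne' t
    have e2 : ((n + 1 : ℕ) : ℝ) ^ (t + 1) = (n : ℝ) ^ (t + 1) * (1 + (n : ℝ)⁻¹) ^ (t + 1) := by
      rw [← Real.mul_rpow hn'.le (by positivity)]
      congr 1
      push_cast
      field_simp
    have : (n : ℝ) ^ t ≠ 0 := (Real.rpow_pos_of_pos hn' t).ne'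
    simp only [Function.comp_apply, hg, e2, e1, smul_eq_mul, inv_inv, Real.one_rpow]
    field_simp
  have ho : (fun k => u k - L / (t + 1) * g k) =o[atTop] g := by
    have hq : Tendsto (fun n : ℕ => (u n - L / (t + 1) * g n) / g n) atTop (𝓝 0) := by
      have h1 := (hu.div hgt ht.ne').sub_const (L / (t + 1))
      rw [sub_self] at h1
      refine h1.congr' ?_
      filter_upwards [hgt.eventually_ne ht.ne', eventually_gt_atTop 0] with n hn hn0
      have hn' : (0 : ℝ) < n := by exact_mod_cast hn0
      have h3 : (n : ℝ) ^ t ≠ 0 := (Real.rpow_pos_of_pos hn' t).ne'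
      have h2 : g n ≠ 0 := fun h => hn (by simp [h])
      simp only [Pi.div_apply]
      rw [div_div_div_cancel_right₀ h3, sub_div, mul_div_cancel_right₀ _ h2]
    refine (Asymptotics.isLittleO_iff_tendsto' ?_).2 hq
    filter_upwards [hgt.eventually_ne ht.ne'] with n hn h
    exact absurd (by simp [h]) hn
  have hs := ho.sum_range hg0 (by simpa only [hsum] using hpow)
  simp only [hsum, Finset.sum_sub_distrib, ← Finset.mul_sum] at hs
  have h1 := hs.tendsto_div_nhds_zero.add_const (L / (t + 1))
  rw [zero_add] at h1
  refine h1.congr' ?_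
  filter_upwards [hpow.eventually_gt_atTop 0] with n hn
  field_simp
  ring

/-- Solutions of convergent square linear systems with nonsingular limit converge. -/
theorem tendsto_of_mulVec_eq {m : ℕ} {A : ℕ → Matrix (Fin m) (Fin m) ℝ}
    {L : Matrix (Fin m) (Fin m) ℝ} (hA : Tendsto A atTop (𝓝 L)) (hL : L.det ≠ 0)
    {x v : ℕ → Fin m → ℝ} {w : Fin m → ℝ} (hv : Tendsto v atTop (𝓝 w))
    (hx : ∀ᶠ n in atTop, (A n).mulVec (x n) = v n) :
    Tendsto x atTop (𝓝 (L⁻¹.mulVec w)) := by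
  have hdet : Tendsto (fun n => (A n).det) atTop (𝓝 L.det) :=
    ((continuous_id.matrix_det).tendsto L).comp hA
  have hadj : Tendsto (fun n => (A n).adjugate.mulVec (v n)) atTop (𝓝 (L.adjugate.mulVec w)) := by
    have h1 : Tendsto (fun n => (A n).adjugate) atTop (𝓝 L.adjugate) :=
      ((continuous_id.matrix_adjugate).tendsto L).comp hA
    rw [tendsto_pi_nhds] at hv ⊢
    intro i
    exact tendsto_finsetSum Finset.univ fun j _ =>
      ((h1.apply_nhds i).apply_nhds j).mul (hv j)
  have hlim : L⁻¹.mulVec w = L.det⁻¹ • L.adjugate.mulVec w := by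
    rw [Matrix.inv_def, Ring.inverse_eq_inv', Matrix.smul_mulVec]
  rw [hlim]
  refine ((hdet.inv₀ hL).smul hadj).congr' ?_
  filter_upwards [hx, hdet.eventually_ne hL] with n hn hd
  rw [← hn, Matrix.mulVec_mulVec, Matrix.adjugate_mul, Matrix.smul_mulVec, Matrix.one_mulVec,
    smul_smul, inv_mul_cancel₀ hd, one_smul]

theorem degree_C_mul_prod_lt {m : ℕ} (s : ℝ) (j : Fin m) (ζ : ℝ) :
    (C ζ * ∏ l ∈ Finset.univ.erase j, (X + C (s + (l : ℕ)))).degree < (m : WithBot ℕ) := by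
  have hm : 0 < m := j.pos
  rw [C_mul']
  refine (degree_smul_le _ _).trans_lt ?_
  rw [degree_prod]
  simp only [degree_X_add_C, Finset.sum_const, Finset.card_erase_of_mem (Finset.mem_univ j),
    Finset.card_univ, Fintype.card_fin]
  rw [nsmul_one]
  exact_mod_cast Nat.sub_lt hm one_pos

theorem degree_sum_cauchy_lt {m : ℕ} (s : ℝ) (ζ : Fin m → ℝ) :
    (∑ j, C (ζ j) * ∏ l ∈ Finset.univ.erase j, (X + C (s + (l : ℕ)))).degree
      < (m : WithBot ℕ) := by
  rw [← mem_degreeLT]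
  exact Submodule.sum_mem _ fun j _ => mem_degreeLT.2 (degree_C_mul_prod_lt s j _)

theorem eval_sum_cauchy {m : ℕ} (s t : ℝ) (ζ : Fin m → ℝ) (h : ∀ l : Fin m, t + (s + (l : ℕ)) ≠ 0) :
    (∑ j, C (ζ j) * ∏ l ∈ Finset.univ.erase j, (X + C (s + (l : ℕ)))).eval t =
      (∏ l : Fin m, (t + (s + (l : ℕ)))) * ∑ j, ζ j / (s + t + (j : ℕ)) := by
  rw [eval_finsetSum, Finset.mul_sum]
  refine Finset.sum_congr rfl fun j _ => ?_
  rw [← Finset.mul_prod_erase _ _ (Finset.mem_univ j)]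
  have := h j
  have h2 : s + t + (j : ℕ) ≠ 0 := by rwa [show s + t + (j : ℕ) = t + (s + (j : ℕ)) by ring]
  simp only [eval_mul, eval_C, eval_prod, eval_add, eval_X]
  rw [show s + t + (j : ℕ) = t + (s + (j : ℕ)) by ring]
  field_simp

/-- The Cauchy matrix `(1 / (s + i + j))` is nonsingular. -/
theorem cauchy_det_ne_zero {m : ℕ} {s : ℝ} (hs : 0 < s) :
    (Matrix.of fun i j : Fin m => 1 / (s + (i : ℕ) + (j : ℕ))).det ≠ 0 := by
  intro hdet
  obtain ⟨ζ, hζ, h0⟩ := Matrix.exists_mulVec_eq_zero_iff.2 hdet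
  apply hζ
  set N : ℝ[X] := ∑ j, C (ζ j) * ∏ l ∈ Finset.univ.erase j, (X + C (s + (l : ℕ))) with hN
  have hN0 : N = 0 := by
    refine eq_zero_of_degree_lt_of_eval_finset_eq_zero (Finset.univ.image fun i : Fin m => (i : ℝ))
      ?_ ?_
    · rw [Finset.card_image_of_injective _ fun i j hij => Fin.ext (Nat.cast_injective hij)]
      simpa only [Finset.card_univ, Fintype.card_fin] using degree_sum_cauchy_lt s ζ
    · intro x hx
      obtain ⟨i, -, rfl⟩ := Finset.mem_image.1 hx
      rw [hN, eval_sum_cauchy s _ ζ fun l => by positivity]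
      have := congrFun h0 i
      simp only [Matrix.mulVec, dotProduct, Matrix.of_apply, Pi.zero_apply] at this
      rw [mul_eq_zero]
      right
      rw [← this]
      exact Finset.sum_congr rfl fun j _ => by ring
  ext j
  have he : N.eval (-(s + (j : ℕ))) = 0 := by rw [hN0, eval_zero]
  rw [hN, eval_finsetSum, Finset.sum_eq_single j] at he
  · simp only [eval_mul, eval_C, eval_prod, eval_add, eval_X, mul_eq_zero,
      Finset.prod_eq_zero_iff] at he
    rcases he with he | ⟨l, hl, he⟩
    · exact he
    · exact absurd (Fin.ext (by
        have : ((l : ℕ) : ℝ) = (j : ℕ) := by linarith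
        exact_mod_cast this)) (Finset.ne_of_mem_erase hl)
  · intro l _ hl
    simp only [eval_mul, eval_C, eval_prod, eval_add, eval_X, mul_eq_zero,
      Finset.prod_eq_zero_iff]
    exact Or.inr ⟨j, Finset.mem_erase.2 ⟨hl.symm, Finset.mem_univ _⟩, by ring⟩
  · simp

/-- The value at `m` of the partial fraction interpolating `1` at `0, …, m - 1`. -/
theorem cauchy_solution_value {m : ℕ} {s : ℝ} (hs : 0 < s) (ζ : Fin m → ℝ)
    (h : ∀ i : Fin m, ∑ j : Fin m, ζ j / (s + (i : ℕ) + (j : ℕ)) = 1) :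
    1 - ∑ j : Fin m, ζ j / (s + m + (j : ℕ)) =
      m.factorial * Real.Gamma (s + m) / Real.Gamma (s + 2 * m) := by
  set S : ℝ[X] := ∑ j, C (ζ j) * ∏ l ∈ Finset.univ.erase j, (X + C (s + (l : ℕ))) with hS
  set Q : ℝ[X] := ∏ l : Fin m, (X + C (s + (l : ℕ))) with hQ
  set R : ℝ[X] := ∏ l : Fin m, (X - C ((l : ℕ) : ℝ)) with hR
  have hQm : Q.Monic := monic_prod_of_monic _ _ fun _ _ => monic_X_add_C _
  have hRm : R.Monic := monic_prod_of_monic _ _ fun _ _ => monic_X_sub_C _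
  have hQd : Q.degree = m := by rw [hQ, degree_prod]; simp only [degree_X_add_C]; simp
  have hRd : R.degree = m := by rw [hR, degree_prod]; simp only [degree_X_sub_C]; simp
  have hQe : ∀ t : ℝ, Q.eval t = ∏ l : Fin m, (t + (s + (l : ℕ))) := fun t => by
    simp [hQ, eval_prod]
  have hD : Q - R - S = 0 := by
    refine eq_zero_of_degree_lt_of_eval_finset_eq_zero (Finset.univ.image fun i : Fin m => (i : ℝ))
      ?_ ?_
    · rw [Finset.card_image_of_injective _ fun i j hij => Fin.ext (Nat.cast_injective hij)]
      refine (degree_sub_le _ _).trans_lt (max_lt ?_ ?_)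
      · have := degree_sub_lt_left (hQd.trans hRd.symm) hQm.ne_zero (by rw [hQm, hRm])
        rw [hQd] at this
        simpa using this
      · simpa only [Finset.card_univ, Fintype.card_fin] using degree_sum_cauchy_lt s ζ
    · intro x hx
      obtain ⟨i, -, rfl⟩ := Finset.mem_image.1 hx
      have hRz : R.eval (i : ℝ) = 0 := by
        rw [hR, eval_prod]
        exact Finset.prod_eq_zero (Finset.mem_univ i) (by simp)
      rw [eval_sub, eval_sub, hRz, hQe, hS, eval_sum_cauchy s _ ζ fun l => by positivity, h i]
      ring
  have hm := congrArg (eval (m : ℝ)) hD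
  rw [eval_sub, eval_sub, hQe, hS, eval_sum_cauchy s _ ζ fun l => by positivity, eval_zero] at hm
  have hRv : R.eval (m : ℝ) = m.factorial := by
    simp only [hR, eval_prod, eval_sub, eval_X, eval_C]
    rw [Fin.prod_univ_eq_prod_range fun l : ℕ => (m : ℝ) - l, ← Nat.descFactorial_self,
      Nat.descFactorial_eq_prod_range, Nat.cast_prod]
    exact Finset.prod_congr rfl fun l hl => by
      rw [Nat.cast_sub (Finset.mem_range.1 hl).le]
  have hG : ∀ k : ℕ, Real.Gamma (s + m + k) =
      (∏ l ∈ Finset.range k, ((m : ℝ) + (s + l))) * Real.Gamma (s + m) := by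
    intro k
    induction k with
    | zero => simp
    | succ k ih =>
      rw [Nat.cast_succ, ← add_assoc, Real.Gamma_add_one (by positivity), ih,
        Finset.prod_range_succ]
      ring
  have hGm := hG m
  rw [← Fin.prod_univ_eq_prod_range (fun l : ℕ => (m : ℝ) + (s + l)),
    show s + m + m = s + 2 * m by ring] at hGm
  have hP : (∏ l : Fin m, ((m : ℝ) + (s + (l : ℕ)))) ≠ 0 :=
    Finset.prod_ne_zero_iff.2 fun l _ => by positivity
  have hΓ : Real.Gamma (s + m) ≠ 0 := (Real.Gamma_pos_of_pos (by positivity)).ne'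
  rw [hGm, eq_div_iff (mul_ne_zero hP hΓ), ← hRv]
  linear_combination Real.Gamma (s + m) * hm

theorem exists_eq_sum_of_degree_lt {S : ℕ → ℝ[X]} (hS : ∀ n, (S n).degree = n) (n : ℕ) :
    ∀ f : ℝ[X], f.degree < n → ∃ e : ℕ → ℝ, f = ∑ k ∈ Finset.range n, C (e k) * S k := by
  induction n with
  | zero =>
    intro f hf
    refine ⟨0, ?_⟩
    simpa [Nat.WithBot.lt_zero_iff] using hf
  | succ n ih =>
    intro f hf
    set t := f.coeff n / (S n).leadingCoeff with ht
    have hlc : (S n).leadingCoeff ≠ 0 := leadingCoeff_ne_zero.2 fun h => by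
      simpa [h] using hS n
    have hnd : (S n).natDegree = n := natDegree_eq_of_degree_eq_some (hS n)
    obtain ⟨e, he⟩ := ih (f - C t * S n) (by
      rw [degree_lt_iff_coeff_zero] at hf ⊢
      intro k hk
      rw [coeff_sub, coeff_C_mul]
      rcases hk.eq_or_lt with rfl | hk
      · rw [leadingCoeff, hnd] at hlc ht
        rw [ht, div_mul_cancel₀ _ hlc, sub_self]
      · rw [hf k hk, coeff_eq_zero_of_natDegree_lt (by omega), mul_zero, sub_zero])
    refine ⟨Function.update e n t, ?_⟩
    rw [Finset.sum_range_succ, Function.update_self, ← sub_eq_iff_eq_add, he]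
    refine Finset.sum_congr rfl fun k hk => ?_
    rw [Function.update_of_ne (Finset.mem_range.1 hk).ne]

theorem eval_iterate_derivative_sum (c : ℝ) (i n : ℕ) (e : ℕ → ℝ) (S : ℕ → ℝ[X]) :
    (derivative^[i] (∑ k ∈ Finset.range n, C (e k) * S k)).eval c =
      ∑ k ∈ Finset.range n, e k * (derivative^[i] (S k)).eval c := by
  rw [iterate_derivative_sum, eval_finsetSum]
  simp

theorem integral_eval_mul_sum {μ : Measure ℝ}
    (hint : ∀ p : ℝ[X], Integrable (fun x => p.eval x) μ) (f : ℝ[X]) (n : ℕ) (e : ℕ → ℝ)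
    (S : ℕ → ℝ[X]) :
    ∫ x, f.eval x * (∑ k ∈ Finset.range n, C (e k) * S k).eval x ∂μ =
      ∑ k ∈ Finset.range n, e k * ∫ x, f.eval x * (S k).eval x ∂μ := by
  have h : ∀ x, f.eval x * (∑ k ∈ Finset.range n, C (e k) * S k).eval x =
      ∑ k ∈ Finset.range n, e k * (f.eval x * (S k).eval x) := fun x => by
    rw [eval_finsetSum, Finset.mul_sum]
    refine Finset.sum_congr rfl fun k _ => ?_
    rw [eval_mul, eval_C]
    ring
  simp only [h]
  rw [integral_finsetSum _ fun k _ => ?_]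
  · simp only [integral_const_mul]
  · simpa only [eval_mul] using (hint (f * S k)).const_mul (e k)

theorem sobInner_sum_right {μ : Measure ℝ}
    (hint : ∀ p : ℝ[X], Integrable (fun x => p.eval x) μ) (c : ℝ) (r : ℕ) (M : ℕ → ℝ)
    (f : ℝ[X]) (n : ℕ) (e : ℕ → ℝ) (S : ℕ → ℝ[X]) :
    sobInner μ c r M f (∑ k ∈ Finset.range n, C (e k) * S k) =
      ∑ k ∈ Finset.range n, e k * sobInner μ c r M f (S k) := by
  simp only [sobInner, integral_eval_mul_sum hint, eval_iterate_derivative_sum, mul_add,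
    Finset.sum_add_distrib, Finset.mul_sum]
  rw [Finset.sum_comm]
  congr 1
  refine Finset.sum_congr rfl fun k _ => Finset.sum_congr rfl fun i _ => ?_
  ring

/-- The connection formula between the Sobolev orthonormal polynomials and the standard ones,
in terms of derivatives at `c`. -/
theorem exists_sobolev_connection {μ : Measure ℝ}
    (hint : ∀ p : ℝ[X], Integrable (fun x => p.eval x) μ) {c : ℝ} {r : ℕ} {M : ℕ → ℝ}
    {p q : ℕ → ℝ[X]} (hp : IsOPS μ p) (hq : IsSobOPS μ c r M q) (n : ℕ) :
    ∃ γ : ℝ, 0 < γ ∧ ∃ x : ℕ → ℝ,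
      (∀ i, x i = M i * (derivative^[i] (q n)).eval c / γ) ∧
      (∀ i, (derivative^[i] (q n)).eval c = γ * ((derivative^[i] (p n)).eval c -
        ∑ j ∈ Finset.range (r + 1), x j * ∑ k ∈ Finset.range n,
          (derivative^[j] (p k)).eval c * (derivative^[i] (p k)).eval c)) ∧
      γ ^ 2 * (1 + ∑ i ∈ Finset.range (r + 1), x i * (derivative^[i] (p n)).eval c) = 1 := by
  obtain ⟨hpd, hpl, hpo⟩ := hp
  obtain ⟨hqd, hql, hqo⟩ := hq
  obtain ⟨e, he⟩ := exists_eq_sum_of_degree_lt hpd (n + 1) (q n)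
    (by rw [hqd]; exact_mod_cast n.lt_succ_self)
  have hcoef : ∀ m ≤ n, ∫ x, (q n).eval x * (p m).eval x ∂μ = e m := fun m hm => by
    simp_rw [mul_comm (eval _ (q n))]
    rw [he, integral_eval_mul_sum hint]
    simp [hpo, hm]
  have horth : ∀ m < n, sobInner μ c r M (q n) (p m) = 0 := fun m hm => by
    obtain ⟨d, hd⟩ := exists_eq_sum_of_degree_lt hqd (m + 1) (p m)
      (by rw [hpd]; exact_mod_cast m.lt_succ_self)
    rw [hd, sobInner_sum_right hint]
    refine Finset.sum_eq_zero fun k hk => ?_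
    have := Finset.mem_range.1 hk
    rw [hqo, if_neg (by omega), mul_zero]
  have hγ : 0 < e n := by
    have hpn : (p n).natDegree = n := natDegree_eq_of_degree_eq_some (hpd n)
    have hqn : (q n).natDegree = n := natDegree_eq_of_degree_eq_some (hqd n)
    have h1 : (q n).coeff n = e n * (p n).coeff n := by
      rw [he, finsetSum_coeff, Finset.sum_range_succ, Finset.sum_eq_zero, zero_add, coeff_C_mul]
      intro k hk
      rw [coeff_C_mul, coeff_eq_zero_of_degree_lt, mul_zero]
      rw [hpd]
      exact_mod_cast Finset.mem_range.1 hk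
    have h2 := hql n
    have h3 := hpl n
    rw [leadingCoeff, hqn, h1] at h2
    rw [leadingCoeff, hpn] at h3
    exact pos_of_mul_pos_left h2 h3.le
  have hM : ∀ i, M i * (derivative^[i] (q n)).eval c =
      e n * (M i * (derivative^[i] (q n)).eval c / e n) := fun i => by field_simp
  refine ⟨e n, hγ, fun i => M i * (derivative^[i] (q n)).eval c / e n, fun _ => rfl, ?_, ?_⟩
  · intro i
    have hlow : ∀ k ∈ Finset.range n, e k = -∑ j ∈ Finset.range (r + 1),
        M j * (derivative^[j] (q n)).eval c * (derivative^[j] (p k)).eval c := fun k hk => by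
      have hk := Finset.mem_range.1 hk
      have := horth k hk
      rw [sobInner, hcoef k hk.le] at this
      linarith
    conv_lhs => rw [he, eval_iterate_derivative_sum, Finset.sum_range_succ]
    rw [Finset.sum_congr rfl fun k hk => by rw [hlow k hk], mul_sub, sub_eq_neg_add]
    congr 1
    simp only [Finset.mul_sum, neg_mul, Finset.sum_neg_distrib, Finset.sum_mul]
    rw [Finset.sum_comm]
    congr 1
    refine Finset.sum_congr rfl fun j _ => Finset.sum_congr rfl fun k _ => ?_
    rw [hM j]
    field_simp
  · have h1 : sobInner μ c r M (q n) (q n) = 1 := by rw [hqo, if_pos rfl]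
    have h2 : sobInner μ c r M (q n) (q n) = e n * sobInner μ c r M (q n) (p n) := by
      conv_lhs => rw [congrArg (sobInner μ c r M (q n)) he]
      rw [sobInner_sum_right hint, Finset.sum_range_succ, Finset.sum_eq_zero, zero_add]
      intro k hk
      rw [horth k (Finset.mem_range.1 hk), mul_zero]
    rw [h1, sobInner, hcoef n le_rfl] at h2
    have h3 : e n * ∑ i ∈ Finset.range (r + 1),
        M i * (derivative^[i] (q n)).eval c / e n * (derivative^[i] (p n)).eval c =
        ∑ i ∈ Finset.range (r + 1),
          M i * (derivative^[i] (q n)).eval c * (derivative^[i] (p n)).eval c := by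
      rw [Finset.mul_sum]
      refine Finset.sum_congr rfl fun i _ => ?_
      field_simp
    linear_combination e n * h3 - h2

/-- Asymptotics of the solutions of the connection system when the data have power growth. -/
theorem tendsto_connection_ratio {m : ℕ} {s β a : ℝ} (hs : 0 < s) (hβ : 0 < β)
    (hlink : 2 * a + 1 = β * s) {τ : ℕ → ℕ → ℝ} {σ : ℕ → ℝ} (hσ : ∀ i, σ i ≠ 0)
    (hτ : ∀ i : ℕ, Tendsto (fun n : ℕ => (-1) ^ n * τ n i / (n : ℝ) ^ (a + β * i)) atTop (𝓝 (σ i)))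
    {M : ℕ → ℝ} (hM : ∀ i < m, 0 < M i) {γ : ℕ → ℝ} (hγ : ∀ n, 0 < γ n) {x y : ℕ → ℕ → ℝ}
    (hx : ∀ n i, x n i = M i * y n i / γ n)
    (hy : ∀ n i, y n i = γ n * (τ n i - ∑ j ∈ Finset.range m,
      x n j * ∑ k ∈ Finset.range n, τ k j * τ k i))
    (hnorm : ∀ n, γ n ^ 2 * (1 + ∑ i ∈ Finset.range m, x n i * τ n i) = 1) :
    Tendsto (fun n => y n m / τ n m) atTop
      (𝓝 (m.factorial * Real.Gamma (s + m) / Real.Gamma (s + 2 * m))) := by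
  set d : ℕ → ℝ := fun i => a + β * i with hd
  have hdd : ∀ i j, d i + d j + 1 = β * (s + i + j) := fun i j => by
    simp only [hd]
    linear_combination hlink
  have hpos : ∀ i j : ℕ, 0 < d i + d j + 1 := fun i j => by
    rw [hdd]
    positivity
  set G : ℕ → ℕ → ℕ → ℝ := fun n i j => ∑ k ∈ Finset.range n, τ k j * τ k i with hG
  set H : ℕ → ℕ → ℕ → ℝ := fun n i j =>
    β * (G n i j / (n : ℝ) ^ (d i + d j + 1)) / (σ i * σ j) with hH
  set v : ℕ → ℕ → ℝ := fun n i => (-1) ^ n * τ n i / (n : ℝ) ^ d i / σ i with hv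
  set Z : ℕ → ℕ → ℝ := fun n j => (-1) ^ n * (n : ℝ) ^ (1 + d j) * σ j * x n j / β with hZ
  have hpow : ∀ t : ℝ, ∀ᶠ n : ℕ in atTop, (0 : ℝ) < (n : ℝ) ^ t := fun t => by
    filter_upwards [eventually_gt_atTop 0] with n hn
    exact Real.rpow_pos_of_pos (by exact_mod_cast hn) t
  have hsq : ∀ n : ℕ, ((-1 : ℝ) ^ n) * (-1) ^ n = 1 := fun n => by
    rw [← mul_pow]; simp
  have hvlim : ∀ i, Tendsto (fun n => v n i) atTop (𝓝 1) := fun i => by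
    simpa [div_self (hσ i)] using (hτ i).div_const (σ i)
  have hHlim : ∀ i j, Tendsto (fun n => H n i j) atTop (𝓝 (1 / (s + i + j))) := fun i j => by
    have h1 := tendsto_sum_range_div_rpow (u := fun k => τ k j * τ k i) (hpos i j)
      (L := σ i * σ j) (by
        refine ((hτ i).mul (hτ j)).congr' ?_
        filter_upwards [eventually_gt_atTop 0] with n hn
        have hn' : (0 : ℝ) < n := by exact_mod_cast hn
        rw [div_mul_div_comm, ← Real.rpow_add hn']
        congr 1
        linear_combination (τ n i * τ n j) * hsq n)
    have h2 := (h1.const_mul β).div_const (σ i * σ j)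
    convert h2 using 2
    rw [hdd]
    have := hσ i
    have := hσ j
    have : s + i + j ≠ 0 := by positivity
    field_simp
  have hεlim : ∀ i : ℕ, Tendsto (fun n : ℕ => β * ((n : ℝ) ^ (2 * d i + 1))⁻¹ / (M i * σ i ^ 2))
      atTop (𝓝 0) := fun i => by
    have h1 : Tendsto (fun n : ℕ => (n : ℝ) ^ (2 * d i + 1)) atTop atTop :=
      (tendsto_rpow_atTop (by have := hpos i i; linarith)).comp tendsto_natCast_atTop_atTop
    simpa using (h1.inv_tendsto_atTop.const_mul β).div_const (M i * σ i ^ 2)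
  have hmat : Tendsto (fun n => Matrix.of fun i j : Fin m => H n i j +
      if i = j then β * ((n : ℝ) ^ (2 * d i + 1))⁻¹ / (M i * σ i ^ 2) else 0) atTop
      (𝓝 (Matrix.of fun i j : Fin m => 1 / (s + (i : ℕ) + (j : ℕ)))) := by
    refine tendsto_pi_nhds.2 fun i => tendsto_pi_nhds.2 fun j => ?_
    simp only [Matrix.of_apply]
    by_cases hij : i = j
    · simpa only [hij, if_true, add_zero] using (hHlim j j).add (hεlim j)
    · simpa only [hij, if_false, add_zero] using hHlim i j
  have hZlim := tendsto_of_mulVec_eq (x := fun n (j : Fin m) => Z n j)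
    (v := fun n (j : Fin m) => v n j) (w := fun _ => 1) hmat (cauchy_det_ne_zero hs)
    (tendsto_pi_nhds.2 fun i => hvlim i) (by
      filter_upwards [eventually_gt_atTop 0] with n hn
      have hn' : (0 : ℝ) < n := by exact_mod_cast hn
      ext i
      have hMi := (hM i i.2).ne'
      have hσi := hσ i
      have key : x n i / M i = τ n i - ∑ j : Fin m, x n j * G n i j := by
        have h1 := hx n i
        have h2 := hy n i
        have h3 := (hγ n).ne'
        rw [h1, Fin.sum_univ_eq_sum_range fun j => x n j * ∑ k ∈ Finset.range n, τ k j * τ k i]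
        rw [mul_div_assoc, mul_div_cancel_left₀ _ hMi, h2, mul_div_cancel_left₀ _ h3]
      simp only [Matrix.mulVec, dotProduct, Matrix.of_apply, add_mul, Finset.sum_add_distrib,
        ite_mul, zero_mul, Finset.sum_ite_eq, Finset.mem_univ, if_true]
      have hterm : ∀ j : Fin m, H n i j * Z n j =
          (-1) ^ n / ((n : ℝ) ^ d i * σ i) * (x n j * G n i j) := fun j => by
        have := hσ j
        have e : (n : ℝ) ^ (d i + d j + 1) = (n : ℝ) ^ d i * (n : ℝ) ^ (1 + d j) := by
          rw [← Real.rpow_add hn']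
          congr 1
          ring
        have h1 := (Real.rpow_pos_of_pos hn' (d i)).ne'
        have h2 := (Real.rpow_pos_of_pos hn' (1 + d j)).ne'
        simp only [hH, hZ, e]
        field_simp
      have hdiag : β * ((n : ℝ) ^ (2 * d i + 1))⁻¹ / (M i * σ i ^ 2) * Z n i =
          (-1) ^ n / ((n : ℝ) ^ d i * σ i) * (x n i / M i) := by
        have e : (n : ℝ) ^ (2 * d i + 1) = (n : ℝ) ^ d i * (n : ℝ) ^ (1 + d i) := by
          rw [← Real.rpow_add hn']
          congr 1
          ring
        have h1 := (Real.rpow_pos_of_pos hn' (d i)).ne'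
        have h2 := (Real.rpow_pos_of_pos hn' (1 + d i)).ne'
        simp only [hZ, e]
        field_simp
      simp only [hterm, hdiag, key, ← Finset.mul_sum, hv]
      field_simp
      ring)
  set ζ := (Matrix.of fun i j : Fin m => 1 / (s + (i : ℕ) + (j : ℕ)))⁻¹.mulVec fun _ => (1 : ℝ)
    with hζ
  have hsys : ∀ i : Fin m, ∑ j : Fin m, ζ j / (s + (i : ℕ) + (j : ℕ)) = 1 := fun i => by
    have h1 : (Matrix.of fun i j : Fin m => 1 / (s + (i : ℕ) + (j : ℕ))).mulVec ζ =
        fun _ => 1 := by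
      rw [hζ, Matrix.mulVec_mulVec, Matrix.mul_nonsing_inv _ (cauchy_det_ne_zero hs).isUnit,
        Matrix.one_mulVec]
    rw [← congrFun h1 i]
    simp only [Matrix.mulVec, dotProduct, Matrix.of_apply]
    exact Finset.sum_congr rfl fun j _ => by ring
  have hZj : ∀ j : Fin m, Tendsto (fun n => Z n j) atTop (𝓝 (ζ j)) := tendsto_pi_nhds.1 hZlim
  have hγlim : Tendsto γ atTop (𝓝 1) := by
    have h1 : Tendsto (fun n => 1 + ∑ i ∈ Finset.range m, x n i * τ n i) atTop (𝓝 1) := by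
      have h2 : Tendsto (fun n : ℕ => 1 + ∑ i : Fin m, β * Z n i * v n i * ((n : ℝ))⁻¹)
          atTop (𝓝 (1 + ∑ i : Fin m, β * ζ i * 1 * 0)) :=
        (tendsto_finsetSum _ fun i _ => (((hZj i).const_mul β).mul (hvlim i)).mul
          tendsto_inv_atTop_nhds_zero_nat).const_add 1
      simp only [mul_zero, Finset.sum_const_zero, add_zero] at h2
      refine h2.congr' ?_
      filter_upwards [eventually_gt_atTop 0] with n hn
      have hn' : (0 : ℝ) < n := by exact_mod_cast hn
      rw [← Fin.sum_univ_eq_sum_range fun j => x n j * τ n j]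
      congr 1
      refine Finset.sum_congr rfl fun i _ => ?_
      have := hσ i
      have h1 := (Real.rpow_pos_of_pos hn' (d i)).ne'
      simp only [hZ, hv, Real.rpow_add hn', Real.rpow_one]
      field_simp
      linear_combination (x n i * τ n i) * hsq n
    have h3 : Tendsto (fun n => √((1 + ∑ i ∈ Finset.range m, x n i * τ n i)⁻¹)) atTop (𝓝 1) := by
      simpa using (h1.inv₀ one_ne_zero).sqrt
    refine h3.congr fun n => ?_
    rw [← eq_inv_of_mul_eq_one_left (hnorm n), Real.sqrt_sq (hγ n).le]
  have hlim : Tendsto (fun n => γ n * (1 - ∑ j : Fin m, Z n j * H n m j / v n m)) atTop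
      (𝓝 (1 * (1 - ∑ j : Fin m, ζ j * (1 / (s + m + (j : ℕ))) / 1))) :=
    hγlim.mul ((tendsto_finsetSum _ fun j _ =>
      ((hZj j).mul (hHlim m j)).div (hvlim m) one_ne_zero).const_sub 1)
  have hval := cauchy_solution_value hs ζ hsys
  simp only [div_one, one_mul, mul_one_div, hval] at hlim
  refine hlim.congr' ?_
  filter_upwards [eventually_gt_atTop 0, (hvlim m).eventually_ne one_ne_zero] with n hn hvn
  have hn' : (0 : ℝ) < n := by exact_mod_cast hn
  have hτn : τ n m ≠ 0 := fun h => hvn (by simp [hv, h])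
  rw [hy, ← Fin.sum_univ_eq_sum_range fun j => x n j * ∑ k ∈ Finset.range n, τ k j * τ k m,
    mul_div_assoc, sub_div, div_self hτn, Finset.sum_div]
  congr 2
  refine Finset.sum_congr rfl fun j _ => ?_
  have h1 := hσ j
  have h2 := hσ m
  have e : (n : ℝ) ^ (d m + d j + 1) = (n : ℝ) ^ d m * (n : ℝ) ^ (1 + d j) := by
    rw [← Real.rpow_add hn']
    congr 1
    ring
  have h3 := (Real.rpow_pos_of_pos hn' (d m)).ne'
  have h4 := (Real.rpow_pos_of_pos hn' (1 + d j)).ne'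
  have h5 : ((-1 : ℝ) ^ n) ≠ 0 := by simp
  simp only [hZ, hH, hv, e]
  field_simp
  rfl

/-- Under the Mehler–Heine hypotheses with all masses positive,
`lim q_n^{(r+1)}(c)/p_n^{(r+1)}(c) = (r+1)! Γ(ν+r+2)/Γ(ν+2r+3)`. -/
theorem ratio_derivative_under_MH
    (μ : Measure ℝ) [IsFiniteMeasure μ]
    (hsupp : (measSupport μ).Infinite)
    (hint : ∀ p : Polynomial ℝ, Integrable (fun x => p.eval x) μ)
    (c : ℝ) (r : ℕ) (M : ℕ → ℝ) (hM : ∀ i ≤ r, 0 < M i)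
    (p : ℕ → Polynomial ℝ) (hp : IsOPS μ p)
    (P : ℕ → ℕ → Polynomial ℝ) (hP0 : P 0 = p)
    (hP : ∀ j ≤ r + 1, IsOPS (muMod μ c (2 * j)) (P j))
    (q : ℕ → Polynomial ℝ) (hq : IsSobOPS μ c r M q)
    (a b : ℕ → ℝ) (ha : ∀ n, 0 < a n) (hb : ∀ n, 0 < b n)
    (A B bexp : ℝ) (aexp : ℝ) (hA : 0 < A) (hB : 0 < B) (hbexp : 0 < bexp)
    (ν : ℝ) (hν : -1 < ν)
    (haA : Filter.Tendsto (fun n : ℕ => (a n) ^ (-(1 : ℝ) / 2) / (A * (n : ℝ) ^ aexp))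
      Filter.atTop (nhds 1))
    (hbB : Filter.Tendsto (fun n : ℕ => b n / (B * (n : ℝ) ^ bexp)) Filter.atTop (nhds 1))
    (hlink : 2 * aexp + 1 = bexp * (ν + 1))
    (hMH : ∀ j ≤ r + 1, ∀ K : Set ℂ, IsCompact K →
      TendstoUniformlyOn
        (fun (n : ℕ) (z : ℂ) =>
          (((-1 : ℝ) ^ n * ((a n) ^ ((1 : ℝ) / 2) / (b n) ^ j) : ℝ) : ℂ) *
            Polynomial.aeval ((c : ℂ) + z ^ 2 / (b n : ℂ)) (P j n))
        (fun z => phi (ν + 2 * j) z) Filter.atTop K) :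
    Filter.Tendsto
      (fun n : ℕ =>
        (Polynomial.derivative^[r + 1] (q n)).eval c /
          (Polynomial.derivative^[r + 1] (p n)).eval c)
      Filter.atTop
      (nhds ((r + 1).factorial * Real.Gamma (ν + r + 2) / Real.Gamma (ν + 2 * r + 3))) := by
  have hpD : ∀ i : ℕ, Tendsto (fun n : ℕ => (-1) ^ n * (derivative^[i] (p n)).eval c /
      (n : ℝ) ^ (aexp + bexp * i)) atTop
      (𝓝 (A * B ^ i * ((-1) ^ i / Real.Gamma (i + ν + 1)))) := fun i => by
    have h1 := tendsto_derivative_of_mehlerHeine hν c p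
      (fun n => (-1) ^ n * a n ^ ((1 : ℝ) / 2)) b (fun K hK => by
        simpa [hP0] using hMH 0 (Nat.zero_le _) K hK) i
    have h2 := ((haA.mul (hbB.pow i)).const_mul (A * B ^ i)).mul h1
    rw [one_pow, mul_one, mul_one] at h2
    refine h2.congr' ?_
    filter_upwards [eventually_gt_atTop 0] with n hn
    have hn' : (0 : ℝ) < n := by exact_mod_cast hn
    have e1 : a n ^ (-(1 : ℝ) / 2) * a n ^ ((1 : ℝ) / 2) = 1 := by
      rw [← Real.rpow_add (ha n)]
      norm_num
    have e2 : (n : ℝ) ^ (aexp + bexp * i) = (n : ℝ) ^ aexp * ((n : ℝ) ^ bexp) ^ i := by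
      rw [Real.rpow_add hn', Real.rpow_mul hn'.le, Real.rpow_natCast]
    have h3 := (Real.rpow_pos_of_pos hn' aexp).ne'
    have h4 := (Real.rpow_pos_of_pos hn' bexp).ne'
    have h5 := (hb n).ne'
    rw [e2, div_pow, mul_pow, inv_pow]
    generalize a n ^ (-(1 : ℝ) / 2) = u at e1 ⊢
    generalize a n ^ ((1 : ℝ) / 2) = w at e1 ⊢
    field_simp
    linear_combination (derivative^[i] (p n)).eval c * e1
  choose γ hγ x hx hy hnorm using exists_sobolev_connection hint hp hq
  have h := tendsto_connection_ratio (m := r + 1) (s := ν + 1) (by linarith) hbexp hlink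
    (fun i => mul_ne_zero (by positivity) (div_ne_zero (by simp)
      (Real.Gamma_pos_of_pos (by have : (0 : ℝ) ≤ i := i.cast_nonneg; linarith)).ne'))
    hpD (fun i hi => hM i (Nat.lt_succ_iff.1 hi)) hγ hx hy hnorm
  rwa [show ν + 1 + ((r + 1 : ℕ) : ℝ) = ν + r + 2 by push_cast; ring,
    show ν + 1 + 2 * ((r + 1 : ℕ) : ℝ) = ν + 2 * r + 3 by push_cast; ring] at h
end
end

section
/- Fix an integer j ≥ 0 and suppose there are sequences a_n, b_n > 0 with a_n^{−1/2}/(A n^a) → 1 and b_n/(B n^b) → 1 for constants A, B, b > 0 and a ∈ ℝ, and ν > −1 with 2a+1 = b(ν+1). Assume, uniformly on compact subsets of ℂ, (−1)^n (a_n^{1/2}/b_n^{j/2}) p_n^{[j]}(c + z²/b_n) → φ_{ν+j}(z). Then: (i) lim_{n→∞} p_n^{[j]}(c)/p_{n−1}^{[j]}(c) = −1; (ii) the kernel values K_n^{[j]}(c,c) := Σ_{i=0}^n (p_i^{[j]}(c))² satisfy lim_{n→∞} K_n^{[j]}(c,c) · b(ν+j+1)/(n (p_n^{[j]}(c))²)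 = 1; and (iii) the leading coefficients satisfy lim_{n→∞} γ_n^{[j]}/γ_{n−1}^{[j+2]} = 1. -/
open MeasureTheory Polynomial Filter Topology

noncomputable section

theorem integral_muMod (μ : Measure ℝ) (c : ℝ) (j : ℕ) (f : ℝ → ℝ) :
    ∫ x, f x ∂(muMod μ c j) = ∫ x, max ((x - c) ^ j) 0 * f x ∂μ := by
  unfold muMod
  rw [integral_withDensity_eq_integral_toReal_smul (by fun_prop)
    (Eventually.of_forall fun _ => ENNReal.ofReal_lt_top)]
  simp [ENNReal.toReal_ofReal']

theorem integrable_eval_muMod {μ : Measure ℝ}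
    (hint : ∀ p : ℝ[X], Integrable (fun x => p.eval x) μ) (c : ℝ) (j : ℕ) (p : ℝ[X]) :
    Integrable (fun x => p.eval x) (muMod μ c j) := by
  unfold muMod
  rw [integrable_withDensity_iff_integrable_smul' (by fun_prop)
    (Eventually.of_forall fun _ => ENNReal.ofReal_lt_top)]
  refine (hint ((X - C c) ^ j * p)).mono
    (by
      have : Measurable fun x : ℝ => (ENNReal.ofReal ((x - c) ^ j)).toReal :=
        Measurable.ennreal_toReal (by fun_prop)
      exact (this.smul p.continuous.measurable).aestronglyMeasurable)
    (Eventually.of_forall fun x => ?_)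
  simp only [ENNReal.toReal_ofReal', smul_eq_mul, norm_mul, eval_mul, eval_pow, eval_sub, eval_X,
    eval_C, Real.norm_eq_abs]
  refine mul_le_mul_of_nonneg_right ?_ (abs_nonneg _)
  rw [abs_of_nonneg (le_max_right _ _)]
  exact max_le (le_abs_self _) (abs_nonneg _)

theorem integral_muMod_add_two (μ : Measure ℝ) (c : ℝ) (j : ℕ) (f : ℝ → ℝ) :
    ∫ x, f x ∂(muMod μ c (j + 2)) = ∫ x, (x - c) ^ 2 * f x ∂(muMod μ c j) := by
  rw [integral_muMod, integral_muMod]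
  congr 1
  ext x
  have h : max ((x - c) ^ (j + 2)) 0 = (x - c) ^ 2 * max ((x - c) ^ j) 0 := by
    rw [mul_max_of_nonneg _ _ (sq_nonneg _), mul_zero, pow_add, mul_comm]
  rw [h]
  ring

namespace IsOPS

variable {μ : Measure ℝ} {P : ℕ → ℝ[X]}

theorem coeff_pos (h : IsOPS μ P) (n : ℕ) : 0 < (P n).coeff n := by
  have := h.2.1 n
  rwa [leadingCoeff, natDegree_eq_of_degree_eq_some (h.1 n)] at this

theorem leadingCoeff_eq (h : IsOPS μ P) (n : ℕ) : (P n).leadingCoeff = (P n).coeff n := by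
  rw [leadingCoeff, natDegree_eq_of_degree_eq_some (h.1 n)]

/-- Subtracting the right multiple of `P n` lowers the degree. -/
theorem degree_sub_lt (h : IsOPS μ P) {n : ℕ} {f : ℝ[X]} (hf : f.degree < (n + 1 : ℕ)) :
    (f - C (f.coeff n / (P n).coeff n) * P n).degree < n := by
  rw [degree_lt_iff_coeff_zero]
  intro m hm
  rcases hm.eq_or_lt with rfl | hm
  · simp [(h.coeff_pos n).ne']
  · have h1 : f.coeff m = 0 := (degree_lt_iff_coeff_zero _ _).1 hf m hm
    have h2 : (P n).coeff m = 0 :=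
      coeff_eq_zero_of_degree_lt (by rw [h.1 n]; exact_mod_cast hm)
    simp [h1, h2]

theorem integral_mul_eq_zero (h : IsOPS μ P)
    (hint : ∀ p : ℝ[X], Integrable (fun x => p.eval x) μ) {n m : ℕ} (hnm : n ≤ m) {f : ℝ[X]}
    (hf : f.degree < n) : ∫ x, f.eval x * (P m).eval x ∂μ = 0 := by
  induction n generalizing f with
  | zero =>
    have : f = 0 := by simpa using hf
    simp [this]
  | succ n ih =>
    set r := f.coeff n / (P n).coeff n with hr
    have h1 := ih (by omega) (h.degree_sub_lt hf)
    have e : ∀ x, f.eval x * (P m).eval x =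
        (f - C r * P n).eval x * (P m).eval x + r * ((P n).eval x * (P m).eval x) := by
      intro x; simp; ring
    simp_rw [e]
    rw [integral_add (by simpa using hint ((f - C r * P n) * P m))
      (by simpa using hint (C r * (P n * P m))), h1, integral_const_mul, h.2.2,
      if_neg (by omega)]
    simp

theorem integral_mul_eq (h : IsOPS μ P)
    (hint : ∀ p : ℝ[X], Integrable (fun x => p.eval x) μ) {n : ℕ} {f : ℝ[X]}
    (hf : f.degree < (n + 1 : ℕ)) :
    ∫ x, f.eval x * (P n).eval x ∂μ = f.coeff n / (P n).coeff n := by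
  set r := f.coeff n / (P n).coeff n with hr
  have h1 := h.integral_mul_eq_zero hint le_rfl (h.degree_sub_lt hf)
  have e : ∀ x, f.eval x * (P n).eval x =
      (f - C r * P n).eval x * (P n).eval x + r * ((P n).eval x * (P n).eval x) := by
    intro x; simp; ring
  simp_rw [e]
  rw [integral_add (by simpa using hint ((f - C r * P n) * P n))
    (by simpa using hint (C r * (P n * P n))), h1, integral_const_mul, h.2.2]
  simp

/-- Extremal property of the leading coefficient of an orthonormal polynomial. -/
theorem sq_coeff_div_le (h : IsOPS μ P)
    (hint : ∀ p : ℝ[X], Integrable (fun x => p.eval x) μ) {n : ℕ} {f : ℝ[X]}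
    (hf : f.degree < (n + 1 : ℕ)) :
    (f.coeff n / (P n).coeff n) ^ 2 ≤ ∫ x, f.eval x ^ 2 ∂μ := by
  have h1 := h.integral_mul_eq hint hf
  set r := f.coeff n / (P n).coeff n with hr
  have h0 : 0 ≤ ∫ x, (f.eval x - r * (P n).eval x) ^ 2 ∂μ :=
    integral_nonneg fun x => sq_nonneg _
  have e : ∀ x, (f.eval x - r * (P n).eval x) ^ 2 =
      f.eval x ^ 2 - 2 * r * (f.eval x * (P n).eval x) +
        r ^ 2 * ((P n).eval x * (P n).eval x) := by
    intro x; ring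
  simp_rw [e] at h0
  have i1 : Integrable (fun x => f.eval x ^ 2) μ := by
    exact (hint (f ^ 2)).congr (Eventually.of_forall fun x => eval_pow 2)
  have i2 : Integrable (fun x => 2 * r * (f.eval x * (P n).eval x)) μ := by
    simpa using hint (C (2 * r) * (f * P n))
  rw [integral_add (f := fun x => f.eval x ^ 2 - 2 * r * (f.eval x * (P n).eval x)) (i1.sub i2)
      (by simpa using hint (C (r ^ 2) * (P n * P n))),
    integral_sub i1 i2, integral_const_mul, integral_const_mul, h1, h.2.2] at h0
  simp only [if_true] at h0
  nlinarith

theorem integral_kernel_sq (h : IsOPS μ P)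
    (hint : ∀ p : ℝ[X], Integrable (fun x => p.eval x) μ) (w : ℕ → ℝ) (n : ℕ) :
    ∫ x, (∑ i ∈ Finset.range n, C (w i) * P i : ℝ[X]).eval x ^ 2 ∂μ =
      ∑ i ∈ Finset.range n, w i ^ 2 := by
  have e : ∀ x, (∑ i ∈ Finset.range n, C (w i) * P i : ℝ[X]).eval x ^ 2 =
      ∑ i ∈ Finset.range n, ∑ k ∈ Finset.range n,
        w i * w k * ((P i).eval x * (P k).eval x) := by
    intro x
    rw [eval_finsetSum, sq, Finset.sum_mul_sum]
    refine Finset.sum_congr rfl fun i _ => Finset.sum_congr rfl fun k _ => ?_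
    simp; ring
  have hi : ∀ i k, Integrable (fun x => w i * w k * ((P i).eval x * (P k).eval x)) μ :=
    fun i k => by simpa using hint (C (w i) * C (w k) * (P i * P k))
  simp_rw [e]
  rw [integral_finsetSum _ fun i _ => integrable_finsetSum _ fun k _ => hi i k]
  refine Finset.sum_congr rfl fun i hmem => ?_
  rw [integral_finsetSum _ fun k _ => hi i k]
  simp_rw [integral_const_mul, h.2.2]
  rw [Finset.sum_eq_single_of_mem i hmem fun k _ hk => by simp [hk.symm]]
  simp [sq]

end IsOPS

theorem one_le_leadingCoeff_ratio {lam lam' : Measure ℝ} {P Q : ℕ → ℝ[X]} {c : ℝ}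
    (hP : IsOPS lam P) (hQ : IsOPS lam' Q)
    (hint : ∀ p : ℝ[X], Integrable (fun x => p.eval x) lam)
    (hlam : ∀ f : ℝ → ℝ, ∫ x, f x ∂lam' = ∫ x, (x - c) ^ 2 * f x ∂lam) (n : ℕ) :
    1 ≤ (P (n + 1)).leadingCoeff / (Q n).leadingCoeff := by
  have hdeg : ((X - C c) * Q n).degree = ((n + 1 : ℕ) : WithBot ℕ) := by
    rw [degree_mul, degree_X_sub_C, hQ.1 n]; push_cast; exact add_comm _ _
  have hco : ((X - C c) * Q n).coeff (n + 1) = (Q n).coeff n := by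
    have := leadingCoeff_mul (X - C c) (Q n)
    rw [leadingCoeff_X_sub_C, one_mul, leadingCoeff, natDegree_eq_of_degree_eq_some hdeg,
      hQ.leadingCoeff_eq] at this
    exact this
  have h1 := hP.sq_coeff_div_le hint (n := n + 1) (f := (X - C c) * Q n)
    (by rw [hdeg]; exact_mod_cast Nat.lt_succ_self _)
  have h2 : ∫ x, ((X - C c) * Q n).eval x ^ 2 ∂lam = 1 := by
    have := hQ.2.2 n n
    rw [hlam] at this
    simp only [if_true] at this
    rw [← this]
    congr 1; ext x; simp; ring
  rw [h2, hco] at h1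
  rw [hP.leadingCoeff_eq, hQ.leadingCoeff_eq, one_le_div (hQ.coeff_pos n)]
  have h3 := (sq_le_one_iff₀ (div_pos (hQ.coeff_pos n) (hP.coeff_pos (n + 1))).le).1 h1
  exact (div_le_one (hP.coeff_pos (n + 1))).1 h3

theorem leadingCoeff_ratio_sq_le {lam lam' : Measure ℝ} {P Q : ℕ → ℝ[X]} {c : ℝ}
    (hP : IsOPS lam P) (hQ : IsOPS lam' Q)
    (hint : ∀ p : ℝ[X], Integrable (fun x => p.eval x) lam)
    (hint' : ∀ p : ℝ[X], Integrable (fun x => p.eval x) lam')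
    (hlam : ∀ f : ℝ → ℝ, ∫ x, f x ∂lam' = ∫ x, (x - c) ^ 2 * f x ∂lam) (n : ℕ)
    (hpos : 0 < ∑ i ∈ Finset.range (n + 1), (P i).eval c ^ 2) :
    ((P (n + 1)).leadingCoeff / (Q n).leadingCoeff) ^ 2 ≤
      (∑ i ∈ Finset.range (n + 2), (P i).eval c ^ 2) /
        ∑ i ∈ Finset.range (n + 1), (P i).eval c ^ 2 := by
  set K := ∑ i ∈ Finset.range (n + 1), (P i).eval c ^ 2 with hK
  set v := (P (n + 1)).eval c with hv
  set w : ℕ → ℝ := fun i => if i = n + 1 then K else - v * (P i).eval c with hw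
  have hw1 : ∀ i ∈ Finset.range (n + 1), w i = - v * (P i).eval c := fun i hi => by
    simp [hw, (Finset.mem_range.1 hi).ne]
  have hw2 : w (n + 1) = K := by simp [hw]
  set G : ℝ[X] := ∑ i ∈ Finset.range (n + 2), C (w i) * P i with hG
  have hGc : G.IsRoot c := by
    rw [IsRoot, hG, eval_finsetSum, Finset.sum_range_succ, hw2]
    have : ∑ i ∈ Finset.range (n + 1), (C (w i) * P i).eval c = - v * K := by
      rw [hK, Finset.mul_sum]
      refine Finset.sum_congr rfl fun i hi => ?_
      rw [hw1 i hi]; simp; ring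
    rw [this]; simp [hv]; ring
  obtain ⟨g, hg⟩ := dvd_iff_isRoot.2 hGc
  have hlow : (∑ i ∈ Finset.range (n + 1), C (w i) * P i : ℝ[X]).degree < (n + 1 : ℕ) := by
    refine (degree_sum_le _ _).trans_lt
      ((Finset.sup_lt_iff (WithBot.bot_lt_coe _)).2 fun i hi => ?_)
    rw [C_mul']
    refine (degree_smul_le _ _).trans_lt ?_
    rw [hP.1 i]
    exact_mod_cast Finset.mem_range.1 hi
  have hGco : G.coeff (n + 1) = K * (P (n + 1)).coeff (n + 1) := by
    rw [hG, Finset.sum_range_succ, coeff_add, coeff_eq_zero_of_degree_lt hlow, hw2]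
    simp
  have hGdeg : G.degree = (n + 1 : ℕ) := by
    rw [hG, Finset.sum_range_succ, degree_add_eq_right_of_degree_lt]
    all_goals rw [hw2, degree_C_mul hpos.ne', hP.1]
    exact hlow
  have hG0 : g ≠ 0 := by
    rintro rfl
    rw [hg, mul_zero, degree_zero] at hGdeg
    exact WithBot.bot_ne_coe hGdeg
  have hgnat : g.natDegree = n := by
    have := natDegree_eq_of_degree_eq_some hGdeg
    rw [hg, natDegree_mul (X_sub_C_ne_zero c) hG0, natDegree_X_sub_C] at this
    omega
  have hgco : g.coeff n = K * (P (n + 1)).coeff (n + 1) := by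
    rw [← hGco]
    have := leadingCoeff_mul (X - C c) g
    rw [leadingCoeff_X_sub_C, one_mul, ← hg, leadingCoeff, natDegree_eq_of_degree_eq_some hGdeg,
      leadingCoeff, hgnat] at this
    exact this.symm
  have h1 := hQ.sq_coeff_div_le hint' (n := n) (f := g)
    ((natDegree_lt_iff_degree_lt hG0).1 (by omega))
  have h2 : ∫ x, g.eval x ^ 2 ∂lam' = K * (K + v ^ 2) := by
    have e : ∑ i ∈ Finset.range (n + 2), w i ^ 2 = K * (K + v ^ 2) := by
      rw [Finset.sum_range_succ, hw2]
      have : ∑ i ∈ Finset.range (n + 1), w i ^ 2 = v ^ 2 * K := by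
        rw [hK, Finset.mul_sum]
        refine Finset.sum_congr rfl fun i hi => ?_
        rw [hw1 i hi]; ring
      rw [this]; ring
    rw [hlam, ← e, ← hP.integral_kernel_sq hint w (n + 2), ← hG]
    congr 1; ext x; rw [hg]; simp; ring
  rw [h2, hgco] at h1
  rw [Finset.sum_range_succ, ← hK, ← hv, hP.leadingCoeff_eq, hQ.leadingCoeff_eq,
    le_div_iff₀ hpos]
  rw [mul_div_assoc, mul_pow, sq K, mul_assoc] at h1
  have := le_of_mul_le_mul_left h1 hpos
  linarith

theorem tendsto_succ_div_rpow (s : ℝ) :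
    Tendsto (fun n : ℕ => (((n + 1 : ℕ) : ℝ) ^ s) / (n : ℝ) ^ s) atTop (𝓝 1) := by
  have h : Tendsto (fun n : ℕ => (((n : ℝ) + 1) / n) ^ s) atTop (𝓝 (1 ^ s)) := by
    refine Tendsto.rpow_const ?_ (Or.inl one_ne_zero)
    have : Tendsto (fun n : ℕ => 1 + 1 / (n : ℝ)) atTop (𝓝 (1 + 0)) :=
      tendsto_const_nhds.add tendsto_one_div_atTop_nhds_zero_nat
    rw [add_zero] at this
    refine this.congr' ?_
    filter_upwards [eventually_gt_atTop 0] with n hn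
    field_simp
  rw [Real.one_rpow] at h
  refine h.congr fun n => ?_
  rw [Real.div_rpow (by positivity) (by positivity)]
  push_cast
  rfl

theorem tendsto_rpow_succ_sub_div (s : ℝ) :
    Tendsto (fun n : ℕ => (((n : ℝ) + 1) ^ (s + 1) - (n : ℝ) ^ (s + 1)) / (n : ℝ) ^ s) atTop
      (𝓝 (s + 1)) := by
  have hd : HasDerivAt (fun x : ℝ => x ^ (s + 1)) (s + 1) 1 := by
    simpa using Real.hasDerivAt_rpow_const (x := 1) (p := s + 1) (Or.inl one_ne_zero)
  have h1 := hd.tendsto_slope_zero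
  have h2 : Tendsto (fun n : ℕ => 1 / (n : ℝ)) atTop (𝓝[≠] 0) := by
    refine tendsto_nhdsWithin_iff.2 ⟨tendsto_one_div_atTop_nhds_zero_nat, ?_⟩
    filter_upwards [eventually_gt_atTop 0] with n hn
    simp [hn.ne']
  refine (h1.comp h2).congr' ?_
  filter_upwards [eventually_gt_atTop 0] with n hn
  have hn' : (0 : ℝ) < n := by exact_mod_cast hn
  have e : (1 : ℝ) + 1 / n = (n + 1) / n := by field_simp
  simp only [Function.comp, e, Real.one_rpow, smul_eq_mul]
  rw [Real.div_rpow (by positivity) hn'.le, Real.rpow_add_one hn'.ne']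
  have := Real.rpow_pos_of_pos hn' s
  field_simp

/-- Partial sums of a sequence with power growth of exponent `s > -1`. -/
theorem tendsto_sum_mul_div_of_rpow {f : ℕ → ℝ} {s E : ℝ} (hs : -1 < s) (hE : E ≠ 0)
    (hf : Tendsto (fun n : ℕ => f n / (n : ℝ) ^ s) atTop (𝓝 E)) :
    Tendsto (fun n : ℕ => (∑ i ∈ Finset.range (n + 1), f i) * (s + 1) / (n * f n)) atTop
      (𝓝 1) := by
  have hs1 : 0 < s + 1 := by linarith
  set g : ℕ → ℝ := fun n => ((n + 1 : ℕ) : ℝ) ^ (s + 1) - (n : ℝ) ^ (s + 1) with hgdef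
  have hsum : ∀ n, ∑ i ∈ Finset.range n, g i = (n : ℝ) ^ (s + 1) := fun n => by
    rw [Finset.sum_range_sub (fun i : ℕ => (i : ℝ) ^ (s + 1))]
    simp [Real.zero_rpow hs1.ne']
  have hg0 : ∀ n, 0 < g n := fun n => by
    have : (n : ℝ) ^ (s + 1) < ((n + 1 : ℕ) : ℝ) ^ (s + 1) :=
      Real.rpow_lt_rpow (by positivity) (by push_cast; linarith) hs1
    simpa [hgdef] using this
  have hinf : Tendsto (fun n : ℕ => (n : ℝ) ^ (s + 1)) atTop atTop :=
    (tendsto_rpow_atTop hs1).comp tendsto_natCast_atTop_atTop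
  have hfg : Tendsto (fun n => f n / g n) atTop (𝓝 (E / (s + 1))) := by
    have := hf.div (tendsto_rpow_succ_sub_div s) hs1.ne'
    refine this.congr' ?_
    filter_upwards [eventually_gt_atTop 0] with n hn
    have hn' : (0 : ℝ) < n := by exact_mod_cast hn
    have := Real.rpow_pos_of_pos hn' s
    simp only [Pi.div_apply, hgdef]
    push_cast
    rw [div_div_div_cancel_right₀ this.ne']
  have ho : (fun n => f n - E / (s + 1) * g n) =o[atTop] g := by
    rw [Asymptotics.isLittleO_iff_tendsto fun n h => absurd h (hg0 n).ne']
    have := hfg.sub_const (E / (s + 1))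
    rw [sub_self] at this
    refine this.congr fun n => ?_
    have := (hg0 n).ne'
    field_simp
  have hS := ho.sum_range (fun n => (hg0 n).le) (by simpa only [hsum] using hinf)
  have hS2 : Tendsto (fun n : ℕ => (∑ i ∈ Finset.range n, f i) / (n : ℝ) ^ (s + 1)) atTop
      (𝓝 (E / (s + 1))) := by
    have h1 := hS.tendsto_div_nhds_zero.add_const (E / (s + 1))
    rw [zero_add] at h1
    refine h1.congr' ?_
    filter_upwards [eventually_gt_atTop 0] with n hn
    have hn' : (0 : ℝ) < n := by exact_mod_cast hn
    have := Real.rpow_pos_of_pos hn' (s + 1)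
    rw [Finset.sum_sub_distrib, ← Finset.mul_sum, hsum]
    field_simp
    ring
  have hS3 := ((tendsto_add_atTop_iff_nat 1).2 hS2).mul (tendsto_succ_div_rpow (s + 1))
  have hfin := (hS3.mul_const (s + 1)).div hf hE
  have e : E / (s + 1) * 1 * (s + 1) / E = 1 := by field_simp
  rw [e] at hfin
  refine hfin.congr' ?_
  filter_upwards [eventually_gt_atTop 0] with n hn
  have hn' : (0 : ℝ) < n := by exact_mod_cast hn
  have h1 := Real.rpow_pos_of_pos hn' s
  have h2 : 0 < ((n + 1 : ℕ) : ℝ) ^ (s + 1) := Real.rpow_pos_of_pos (by positivity) _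
  simp only [Pi.div_apply]
  rw [Real.rpow_add_one hn'.ne']
  by_cases hfn : f n = 0
  · simp [hfn]
  · field_simp

theorem tendsto_ratio_of_rpow {f : ℕ → ℝ} {s D : ℝ} (hD : D ≠ 0)
    (hf : Tendsto (fun n : ℕ => (-1) ^ n * f n / (n : ℝ) ^ s) atTop (𝓝 D)) :
    Tendsto (fun n : ℕ => f n / f (n - 1)) atTop (𝓝 (-1)) := by
  rw [← tendsto_add_atTop_iff_nat 1]
  have h := ((((tendsto_add_atTop_iff_nat 1).2 hf).div hf hD).mul (tendsto_succ_div_rpow s)).neg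
  rw [div_self hD, one_mul] at h
  refine h.congr' ?_
  filter_upwards [eventually_gt_atTop 0] with n hn
  have hn' : (0 : ℝ) < n := by exact_mod_cast hn
  have h1 := Real.rpow_pos_of_pos hn' s
  have h2 : 0 < ((n + 1 : ℕ) : ℝ) ^ s := Real.rpow_pos_of_pos (by positivity) _
  have h3 : ((-1 : ℝ)) ^ n ≠ 0 := by simp
  simp only [Pi.div_apply, Nat.add_sub_cancel]
  rw [pow_succ]
  by_cases hfn : f n = 0
  · simp [hfn]
  · field_simp

theorem phi_zero (ν : ℝ) : phi ν 0 = ((1 / Real.Gamma (ν + 1) : ℝ) : ℂ) := by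
  unfold phi
  rw [tsum_eq_single 0 fun k hk => by simp [hk]]
  simp [← Complex.Gamma_ofReal]

/-- **Consequences of a Mehler–Heine formula for the index `j`:**
(i) `p_n^{[j]}(c)/p_{n-1}^{[j]}(c) → -1`;
(ii) `K_n^{[j]}(c,c) ≅ n (p_n^{[j]}(c))²/(b(ν+j+1))`;
(iii) `γ_n^{[j]}/γ_{n-1}^{[j+2]} → 1`. -/
theorem mehler_heine_consequences
    (μ : Measure ℝ) [IsFiniteMeasure μ]
    (hsupp : (measSupport μ).Infinite)
    (hint : ∀ p : Polynomial ℝ, Integrable (fun x => p.eval x) μ)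
    (c : ℝ) (j : ℕ)
    (P : ℕ → ℕ → Polynomial ℝ)
    (hP : ∀ i, IsOPS (muMod μ c i) (P i))
    (a b : ℕ → ℝ) (ha : ∀ n, 0 < a n) (hb : ∀ n, 0 < b n)
    (A B bexp : ℝ) (aexp : ℝ) (hA : 0 < A) (hB : 0 < B) (hbexp : 0 < bexp)
    (ν : ℝ) (hν : -1 < ν)
    (haA : Filter.Tendsto (fun n : ℕ => (a n) ^ (-(1 : ℝ) / 2) / (A * (n : ℝ) ^ aexp))
      Filter.atTop (nhds 1))
    (hbB : Filter.Tendsto (fun n : ℕ => b n / (B * (n : ℝ) ^ bexp)) Filter.atTop (nhds 1))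
    (hlink : 2 * aexp + 1 = bexp * (ν + 1))
    (hMHj : ∀ K : Set ℂ, IsCompact K →
      TendstoUniformlyOn
        (fun (n : ℕ) (z : ℂ) =>
          (((-1 : ℝ) ^ n * ((a n) ^ ((1 : ℝ) / 2) / (b n) ^ ((j : ℝ) / 2)) : ℝ) : ℂ) *
            Polynomial.aeval ((c : ℂ) + z ^ 2 / (b n : ℂ)) (P j n))
        (fun z => phi (ν + j) z) Filter.atTop K) :
    Filter.Tendsto (fun n : ℕ => (P j n).eval c / (P j (n - 1)).eval c)
      Filter.atTop (nhds (-1)) ∧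
    Filter.Tendsto
      (fun n : ℕ =>
        (∑ i ∈ Finset.range (n + 1), ((P j i).eval c) ^ 2) * (bexp * (ν + j + 1)) /
          ((n : ℝ) * ((P j n).eval c) ^ 2))
      Filter.atTop (nhds 1) ∧
    Filter.Tendsto (fun n : ℕ => (P j n).leadingCoeff / (P (j + 2) (n - 1)).leadingCoeff)
      Filter.atTop (nhds 1) := by
  have hνj : 0 < ν + j + 1 := by have := Nat.cast_nonneg (α := ℝ) j; linarith
  set L : ℝ := 1 / Real.Gamma (ν + j + 1) with hL
  have hL0 : 0 < L := one_div_pos.2 (Real.Gamma_pos_of_pos hνj)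
  set σ : ℝ := aexp + bexp * (j / 2) with hσ
  have hσ1 : 2 * σ + 1 = bexp * (ν + j + 1) := by rw [hσ]; linarith
  have hpt : Tendsto (fun n : ℕ => (-1 : ℝ) ^ n * ((a n) ^ ((1 : ℝ) / 2) / (b n) ^ ((j : ℝ) / 2)) *
      (P j n).eval c) atTop (𝓝 L) := by
    have h := (hMHj {0} isCompact_singleton).tendsto_at (Set.mem_singleton (0 : ℂ))
    rw [phi_zero] at h
    rw [← tendsto_ofReal_iff]
    refine h.congr fun n => ?_
    have e : Polynomial.aeval ((c : ℂ) + 0 ^ 2 / (b n : ℂ)) (P j n) =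
        (((P j n).eval c : ℝ) : ℂ) := by
      rw [zero_pow two_ne_zero, zero_div, add_zero]
      exact aeval_algebraMap_apply_eq_algebraMap_eval c (P j n)
    rw [e, ← Complex.ofReal_mul]
  have hbj : Tendsto (fun n : ℕ => (b n / (B * (n : ℝ) ^ bexp)) ^ ((j : ℝ) / 2)) atTop (𝓝 1) := by
    simpa using hbB.rpow_const (p := (j : ℝ) / 2) (Or.inl one_ne_zero)
  set D : ℝ := L * A * B ^ ((j : ℝ) / 2) with hD
  have hD0 : D ≠ 0 := by positivity
  have hgrow : Tendsto (fun n : ℕ => (-1) ^ n * (P j n).eval c / (n : ℝ) ^ σ) atTop (𝓝 D) := by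
    have h := ((hpt.mul haA).mul hbj).mul_const (A * B ^ ((j : ℝ) / 2))
    rw [mul_one, mul_one, ← mul_assoc] at h
    refine h.congr' ?_
    filter_upwards [eventually_gt_atTop 0] with n hn
    have hn' : (0 : ℝ) < n := by exact_mod_cast hn
    have hσn : (n : ℝ) ^ σ = (n : ℝ) ^ aexp * (n : ℝ) ^ (bexp * (j / 2)) := Real.rpow_add hn' _ _
    rw [Real.div_rpow (hb n).le (by positivity), Real.mul_rpow hB.le (by positivity),
      ← Real.rpow_mul hn'.le, hσn, neg_div, Real.rpow_neg (ha n).le]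
    have h1 := Real.rpow_pos_of_pos (ha n) (1 / 2)
    have h2 := Real.rpow_pos_of_pos (hb n) ((j : ℝ) / 2)
    have h3 := Real.rpow_pos_of_pos hB ((j : ℝ) / 2)
    have h4 := Real.rpow_pos_of_pos hn' aexp
    have h5 := Real.rpow_pos_of_pos hn' (bexp * (j / 2))
    field_simp
  have hsq : Tendsto (fun n : ℕ => (P j n).eval c ^ 2 / (n : ℝ) ^ (2 * σ)) atTop (𝓝 (D ^ 2)) := by
    refine (hgrow.pow 2).congr fun n => ?_
    rw [div_pow, mul_pow, ← pow_mul, mul_comm n 2, pow_mul, neg_one_sq, one_pow, one_mul,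
      mul_comm 2 σ, Real.rpow_mul (Nat.cast_nonneg n), Real.rpow_two]
  have hpos1 : 0 < bexp * (ν + j + 1) := mul_pos hbexp hνj
  have hker := tendsto_sum_mul_div_of_rpow (by linarith) (pow_ne_zero 2 hD0) hsq
  rw [hσ1] at hker
  refine ⟨tendsto_ratio_of_rpow hD0 hgrow, hker, ?_⟩
  set K : ℕ → ℝ := fun n => ∑ i ∈ Finset.range (n + 1), (P j i).eval c ^ 2 with hK
  have hKpos : ∀ n, 0 < K n := fun n => by
    refine Finset.sum_pos' (fun i _ => sq_nonneg _) ⟨0, by simp, ?_⟩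
    have h0 : P j 0 = C ((P j 0).coeff 0) := eq_C_of_degree_eq_zero (by simpa using (hP j).1 0)
    have h1 := (hP j).coeff_pos 0
    rw [h0, eval_C]
    positivity
  have hq : Tendsto (fun n : ℕ => (P j n).eval c ^ 2 / K n) atTop (𝓝 0) := by
    have h := (hker.inv₀ one_ne_zero).mul
      (tendsto_const_div_atTop_nhds_zero_nat (bexp * (ν + j + 1)))
    rw [mul_zero] at h
    refine h.congr' ?_
    filter_upwards [eventually_gt_atTop 0] with n hn
    have hn' : (0 : ℝ) < n := by exact_mod_cast hn
    have h1 := hKpos n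
    change (K n * (bexp * (ν + j + 1)) / (n * (P j n).eval c ^ 2))⁻¹ * _ = _
    rw [inv_div, div_mul_div_comm, div_eq_div_iff (by positivity) h1.ne']
    ring
  have hrat : Tendsto (fun n : ℕ => √(K (n + 1) / K n)) atTop (𝓝 1) := by
    have h := ((((tendsto_add_atTop_iff_nat 1).2 hq).const_sub 1).inv₀ (by simp)).sqrt
    rw [sub_zero, inv_one, Real.sqrt_one] at h
    refine h.congr fun n => ?_
    have e : K (n + 1) = K n + (P j (n + 1)).eval c ^ 2 := Finset.sum_range_succ _ _
    have h1 := hKpos n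
    have h2 := hKpos (n + 1)
    congr 1
    rw [one_sub_div h2.ne', inv_div]
    congr 1
    rw [e]; ring
  rw [← tendsto_add_atTop_iff_nat 1]
  have hintj := integrable_eval_muMod hint c
  refine tendsto_of_tendsto_of_tendsto_of_le_of_le tendsto_const_nhds hrat (fun n => ?_) fun n => ?_
  · exact one_le_leadingCoeff_ratio (hP j) (hP (j + 2)) (hintj j)
      (integral_muMod_add_two μ c j) n
  · exact Real.le_sqrt_of_sq_le (leadingCoeff_ratio_sq_le (hP j) (hP (j + 2)) (hintj j)
      (hintj (j + 2)) (integral_muMod_add_two μ c j) n (hKpos n))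
end
end
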